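/- arXiv:1807.02801 — 2 statements merged into one kernel-verified Lean document; each statement's English description precedes it below -/
import Mathlib

section
/- Under the hypotheses of the characteristic system with r, ℓ > 0, w < 0, enclosed mass 0 ≤ m(t,R(t)) ≤ M, there cannot exist a solution with W(t) ≤ 0 for all t ≥ 0 and R(t) ≤ r for all t ≥ 0. More precisely, if W(t) ≤ 0 and R(t) ≤ r on [0, T], and W(t)² + ℓR(t)⁻² ≤ w² + ℓr⁻² on [0,T], then W(T) ≥ w + (ℓ/(r³√(1 + w² + ℓ r⁻²))) T; consequently if T > -w r³ √(1 + w² + ℓ r⁻²)/ℓ then W(T) > 0, a contradiction. Hence the first time T₀ at which W vanishes satisfies T₀ ≤ -w r³ √(1 + w² + ℓ r⁻²)/ℓ. -/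
theorem turning_time_upper_bound (r ℓ w M T : ℝ)
    (hr : 0 < r) (hl : 0 < ℓ) (hw : w < 0) (hM : 0 ≤ M) (hT : 0 ≤ T)
    (R W : ℝ → ℝ) (m : ℝ → ℝ → ℝ)
    (hWderiv : ∀ t ∈ Set.Icc 0 T, HasDerivAt W
      (ℓ / (R t ^ 3 * Real.sqrt (1 + W t ^ 2 + ℓ * (R t)⁻¹ ^ 2))
        + m t (R t) / R t ^ 2) t)
    (hW0 : W 0 = w)
    (hRpos : ∀ t ∈ Set.Icc 0 T, 0 < R t)
    (hm : ∀ t ∈ Set.Icc 0 T, 0 ≤ m t (R t) ∧ m t (R t) ≤ M)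
    (hWneg : ∀ t ∈ Set.Icc 0 T, W t ≤ 0)
    (hRle : ∀ t ∈ Set.Icc 0 T, R t ≤ r)
    (henergy : ∀ t ∈ Set.Icc 0 T,
      W t ^ 2 + ℓ * (R t)⁻¹ ^ 2 ≤ w ^ 2 + ℓ * r⁻¹ ^ 2) :
    W T ≥ w + (ℓ / (r ^ 3 * Real.sqrt (1 + w ^ 2 + ℓ * r⁻¹ ^ 2))) * T ∧
      (T > -w * r ^ 3 * Real.sqrt (1 + w ^ 2 + ℓ * r⁻¹ ^ 2) / ℓ →
        W T > 0) := by
  set S := Real.sqrt (1 + w ^ 2 + ℓ * r⁻¹ ^ 2) with hS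
  have hSpos : 0 < S := Real.sqrt_pos.mpr (by positivity)
  have hbound : W T ≥ w + (ℓ / (r ^ 3 * S)) * T := by
    have hderiv : ∀ t ∈ interior (Set.Icc 0 T), ℓ / (r ^ 3 * S) ≤ deriv W t := by
      intro t ht
      have ht' := interior_subset ht
      rw [(hWderiv t ht').deriv]
      have hRt := hRpos t ht'
      have hmass : 0 ≤ m t (R t) / R t ^ 2 := div_nonneg (hm t ht').1 (sq_nonneg _)
      have hsqrt_pos : 0 < Real.sqrt (1 + W t ^ 2 + ℓ * (R t)⁻¹ ^ 2) :=
        Real.sqrt_pos.mpr (by positivity)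
      have hsqrt_le : Real.sqrt (1 + W t ^ 2 + ℓ * (R t)⁻¹ ^ 2) ≤ S :=
        Real.sqrt_le_sqrt (by linarith [henergy t ht'])
      have hcentrifugal : ℓ / (r ^ 3 * S)
          ≤ ℓ / (R t ^ 3 * Real.sqrt (1 + W t ^ 2 + ℓ * (R t)⁻¹ ^ 2)) := by
        have hRr := hRle t ht'
        gcongr
      linarith
    have hgrowth := (convex_Icc 0 T).mul_sub_le_image_sub_of_le_deriv
      (fun t ht => (hWderiv t ht).continuousAt.continuousWithinAt)
      (fun t ht => (hWderiv t (interior_subset ht)).differentiableAt.differentiableWithinAt)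
      hderiv 0 (Set.left_mem_Icc.mpr hT) T (Set.right_mem_Icc.mpr hT) hT
    rw [hW0, sub_zero] at hgrowth
    linarith
  refine ⟨hbound, fun hlarge => ?_⟩
  have hdrop : -w < ℓ / (r ^ 3 * S) * T := by
    rw [gt_iff_lt, div_lt_iff₀ hl] at hlarge
    rw [div_mul_eq_mul_div, lt_div_iff₀ (by positivity)]
    linarith
  linarith
end

section
/- Let r, ℓ > 0, w < 0, and let (R, W) be the characteristic with R(0) = r, W(0) = w on [0, T₀] where W(T₀) = 0 and W ≤ 0 on [0,T₀]. Assume R̈(t) ≥ 0 on [0,T₀] and R(T₀) ≤ R₊ := r√(D/(r²w² + D)) with D = ℓ + Mr√(1 + w² + ℓr⁻²). Then T₀ ≥ r(1 - √(D/(r²w² + D))). -/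
/-- The relativistic speed `W / √(1 + W² + a)` with `a ≥ 0` is at least `-1`. -/
lemma neg_one_le_div_sqrt_one_add_sq_add (W : ℝ) {a : ℝ} (ha : 0 ≤ a) :
    -1 ≤ W / Real.sqrt (1 + W ^ 2 + a) := by
  have hpos : 0 < Real.sqrt (1 + W ^ 2 + a) := Real.sqrt_pos.mpr (by positivity)
  rw [le_div_iff₀ hpos]
  have : |W| ≤ Real.sqrt (1 + W ^ 2 + a) := Real.abs_le_sqrt (by linarith)
  linarith [neg_abs_le W]

theorem turning_time_lower_bound (r ℓ w M T₀ : ℝ)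
    (hr : 0 < r) (hl : 0 < ℓ) (hw : w < 0) (hM : 0 ≤ M) (hT : 0 ≤ T₀)
    (R W R' R'' : ℝ → ℝ)
    (hRderiv : ∀ t ∈ Set.Icc 0 T₀, HasDerivAt R (R' t) t)
    (hR' : ∀ t ∈ Set.Icc 0 T₀,
      R' t = W t / Real.sqrt (1 + W t ^ 2 + ℓ * (R t)⁻¹ ^ 2))
    (hR'deriv : ∀ t ∈ Set.Icc 0 T₀, HasDerivAt R' (R'' t) t)
    (hconvex : ∀ t ∈ Set.Icc 0 T₀, 0 ≤ R'' t)
    (hR0 : R 0 = r) (hW0 : W 0 = w)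
    (hWneg : ∀ t ∈ Set.Icc 0 T₀, W t ≤ 0) (hWT0 : W T₀ = 0)
    (D : ℝ) (hD : D = ℓ + M * r * Real.sqrt (1 + w ^ 2 + ℓ * r⁻¹ ^ 2))
    (hRT0 : R T₀ ≤ r * Real.sqrt (D / (r ^ 2 * w ^ 2 + D))) :
    T₀ ≥ r * (1 - Real.sqrt (D / (r ^ 2 * w ^ 2 + D))) := by
  have hmvt : (-1) * (T₀ - 0) ≤ R T₀ - R 0 := by
    refine (convex_Icc 0 T₀).mul_sub_le_image_sub_of_le_deriv
      (fun t ht => (hRderiv t ht).continuousAt.continuousWithinAt)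
      (fun t ht => (hRderiv t (interior_subset ht)).differentiableAt.differentiableWithinAt)
      (fun t ht => ?_) 0 ⟨le_rfl, hT⟩ T₀ ⟨hT, le_rfl⟩ hT
    have ht' := interior_subset ht
    rw [(hRderiv t ht').deriv, hR' t ht']
    exact neg_one_le_div_sqrt_one_add_sq_add _ (by positivity)
  linarith
end
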